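/- Let E be a complex Banach space with nontrivial Rademacher type, i.e., having Rademacher type s with constant T for some s ∈ (1,2] and T ∈ (0,∞). Then for every p ∈ (1,∞) and α ∈ (0,∞) there exists K_p(α) = K_p(α,s,T) ∈ (0,∞) such that for every n ∈ ℕ and every function f : 𝒞_n → E, ‖Δ^{−α} f‖_{L_p(σ_n;E)} ≤ K_p(α) ‖f‖_{L_p(σ_n;E)} / (1 + log^{α}(‖f‖_{L_p(σ_n;E)} / ‖f‖_{L_1(σ_n;E)})), with the convention that the right-hand side is 0 when f vanishes identically. -/

import Mathlib

open Finset MeasureTheory Real Filter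

noncomputable section

/-- The discrete hypercube `𝒞_n = {-1,1}^n`, encoded as `Fin n → Bool`. -/
abbrev Cube (n : ℕ) := Fin n → Bool

/-- The sign `±1` associated to a boolean coordinate. -/
def sgn' (b : Bool) : ℝ := if b then 1 else -1

/-- Flip the `i`-th coordinate of a point of the hypercube. -/
def flipC {n : ℕ} (i : Fin n) (x : Cube n) : Cube n := Function.update x i (!(x i))

variable {E : Type*} [NormedAddCommGroup E]

/-- Expectation `E_{σ_n} f` with respect to the uniform probability measure on the cube. -/
def cubeAvg {n : ℕ} [NormedSpace ℝ E] (f : Cube n → E) : E :=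
  (2 ^ n : ℝ)⁻¹ • ∑ x : Cube n, f x

/-- The discrete partial derivative `∂_i f (ε) = (f(ε) - f(ε with i-th coordinate flipped))/2`. -/
def dparC {n : ℕ} [NormedSpace ℝ E] (i : Fin n) (f : Cube n → E) : Cube n → E :=
  fun x => (2 : ℝ)⁻¹ • (f x - f (flipC i x))

/-- The `L_p(σ_n; E)` norm of a function on the hypercube. -/
def cubeLp {n : ℕ} (p : ℝ) (f : Cube n → E) : ℝ :=
  ((2 ^ n : ℝ)⁻¹ * ∑ x : Cube n, ‖f x‖ ^ p) ^ (1 / p)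
/-- The Walsh function `w_A(ε) = ∏_{i ∈ A} ε_i`. -/
def walshC {n : ℕ} (A : Finset (Fin n)) (x : Cube n) : ℝ := ∏ i ∈ A, sgn' (x i)

/-- The Walsh–Fourier coefficient `f̂(A) ∈ E` of `f : 𝒞_n → E`. -/
def fhatC {n : ℕ} [NormedSpace ℝ E] (f : Cube n → E) (A : Finset (Fin n)) : E :=
  (2 ^ n : ℝ)⁻¹ • ∑ x : Cube n, walshC A x • f x

/-- The negative power of the hypercube Laplacian, defined spectrally:
`Δ^{-α} f = ∑_{∅ ≠ A} |A|^{-α} f̂(A) w_A`. -/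
def negLap {n : ℕ} [NormedSpace ℝ E] (α : ℝ) (f : Cube n → E) : Cube n → E :=
  fun x => ∑ A ∈ Finset.univ.filter (fun A : Finset (Fin n) => A ≠ ∅),
    (((A.card : ℝ) ^ (-α)) * walshC A x) • fhatC f A

lemma sgn'_true : sgn' true = 1 := rfl

lemma sgn'_false : sgn' false = -1 := rfl

lemma sgn'_mul_self (b : Bool) : sgn' b * sgn' b = 1 := by cases b <;> simp [sgn']

lemma abs_sgn' (b : Bool) : |sgn' b| = 1 := by cases b <;> simp [sgn']

/-- The kernel of the noise operator with a separate correlation `ρ i` for every coordinate. -/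
def noiseKer {n : ℕ} (ρ : Fin n → ℝ) (x y : Cube n) : ℝ :=
  ∏ i, ((1 + ρ i * sgn' (x i) * sgn' (y i)) / 2)

lemma noiseKer_nonneg {n : ℕ} {ρ : Fin n → ℝ} (hρ : ∀ i, |ρ i| ≤ 1) (x y : Cube n) :
    0 ≤ noiseKer ρ x y := by
  refine Finset.prod_nonneg fun i _ => ?_
  have h : |ρ i * sgn' (x i) * sgn' (y i)| ≤ 1 := by
    rw [abs_mul, abs_mul, abs_sgn', abs_sgn']; simpa using hρ i
  linarith [(abs_le.1 h).1]

lemma noiseKer_comm {n : ℕ} (ρ : Fin n → ℝ) (x y : Cube n) :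
    noiseKer ρ x y = noiseKer ρ y x :=
  Finset.prod_congr rfl fun i _ => by ring

lemma sum_cube_prod {n : ℕ} (F : Fin n → Bool → ℝ) :
    ∑ y : Cube n, ∏ i, F i (y i) = ∏ i, (F i true + F i false) := by
  have h := Finset.prod_univ_sum (fun _ : Fin n => (Finset.univ : Finset Bool)) F
  rw [Fintype.piFinset_univ] at h
  rw [← h]
  simp

lemma sum_noiseKer {n : ℕ} (ρ : Fin n → ℝ) (x : Cube n) : ∑ y, noiseKer ρ x y = 1 := by
  unfold noiseKer
  rw [sum_cube_prod (fun i b => (1 + ρ i * sgn' (x i) * sgn' b) / 2)]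
  refine Finset.prod_eq_one fun i _ => ?_
  simp only [sgn'_true, sgn'_false]
  ring

lemma sum_noiseKer_left {n : ℕ} (ρ : Fin n → ℝ) (y : Cube n) : ∑ x, noiseKer ρ x y = 1 := by
  simp_rw [noiseKer_comm ρ _ y]
  exact sum_noiseKer ρ y

lemma noiseKer_comp {n : ℕ} (ρ σ : Fin n → ℝ) (x z : Cube n) :
    ∑ y, noiseKer ρ x y * noiseKer σ y z = noiseKer (ρ * σ) x z := by
  unfold noiseKer
  simp_rw [← Finset.prod_mul_distrib]
  rw [sum_cube_prod (fun i b => (1 + ρ i * sgn' (x i) * sgn' b) / 2 *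
    ((1 + σ i * sgn' b * sgn' (z i)) / 2))]
  refine Finset.prod_congr rfl fun i _ => ?_
  simp only [sgn'_true, sgn'_false, Pi.mul_apply]
  ring

lemma noiseKer_zero {n : ℕ} (x y : Cube n) : noiseKer 0 x y = (2 ^ n : ℝ)⁻¹ := by
  simp [noiseKer]

lemma noiseKer_one {n : ℕ} (x y : Cube n) : noiseKer 1 x y = if y = x then 1 else 0 := by
  unfold noiseKer
  split_ifs with h
  · subst h
    refine Finset.prod_eq_one fun i _ => ?_
    rw [Pi.one_apply, one_mul, sgn'_mul_self]; norm_num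
  · obtain ⟨i, hi⟩ := Function.ne_iff.1 h
    refine Finset.prod_eq_zero (Finset.mem_univ i) ?_
    rw [Pi.one_apply]
    revert hi
    cases x i <;> cases y i <;> simp [sgn']

/-- The noise operator with correlations `ρ`. -/
def noise {n : ℕ} [NormedSpace ℝ E] (ρ : Fin n → ℝ) : (Cube n → E) →ₗ[ℝ] (Cube n → E) where
  toFun f x := ∑ y, noiseKer ρ x y • f y
  map_add' f g := by ext x; simp [Finset.sum_add_distrib]
  map_smul' c f := by
    ext x
    simp only [Pi.smul_apply, RingHom.id_apply, Finset.smul_sum]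
    exact Finset.sum_congr rfl fun y _ => smul_comm _ _ _

section noise

variable [NormedSpace ℝ E] {n : ℕ}

lemma noise_apply (ρ : Fin n → ℝ) (f : Cube n → E) (x : Cube n) :
    noise ρ f x = ∑ y, noiseKer ρ x y • f y := rfl

lemma noise_noise (ρ σ : Fin n → ℝ) (f : Cube n → E) :
    noise ρ (noise σ f) = noise (ρ * σ) f := by
  ext x
  simp only [noise_apply, Finset.smul_sum, smul_smul]
  rw [Finset.sum_comm]
  simp_rw [← Finset.sum_smul, noiseKer_comp]

lemma noise_const_noise_const (r t : ℝ) (f : Cube n → E) :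
    noise (fun _ => r) (noise (fun _ => t) f) = noise (fun _ => r * t) f :=
  noise_noise _ _ f

lemma noise_one (f : Cube n → E) : noise 1 f = f := by
  ext x
  simp [noise_apply, noiseKer_one]

lemma noise_zero_apply (f : Cube n → E) (x : Cube n) : noise 0 f x = cubeAvg f := by
  simp [noise_apply, noiseKer_zero, cubeAvg, Finset.smul_sum]

lemma norm_noise_le {ρ : Fin n → ℝ} (hρ : ∀ i, |ρ i| ≤ 1) (f : Cube n → E) (x : Cube n) :
    ‖noise ρ f x‖ ≤ noise ρ (fun y => ‖f y‖) x := by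
  rw [noise_apply, noise_apply]
  refine (norm_sum_le _ _).trans (le_of_eq (Finset.sum_congr rfl fun y _ => ?_))
  rw [norm_smul, Real.norm_of_nonneg (noiseKer_nonneg hρ x y), smul_eq_mul]

lemma noise_nonneg {ρ : Fin n → ℝ} (hρ : ∀ i, |ρ i| ≤ 1) {g : Cube n → ℝ} (hg : ∀ x, 0 ≤ g x)
    (x : Cube n) : 0 ≤ noise ρ g x :=
  Finset.sum_nonneg fun y _ => mul_nonneg (noiseKer_nonneg hρ x y) (hg y)

lemma noise_rpow_le {ρ : Fin n → ℝ} (hρ : ∀ i, |ρ i| ≤ 1) {g : Cube n → ℝ}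
    (hg : ∀ x, 0 ≤ g x) {q : ℝ} (hq : 1 ≤ q) (x : Cube n) :
    noise ρ g x ^ q ≤ noise ρ (fun y => g y ^ q) x :=
  Real.rpow_arith_mean_le_arith_mean_rpow _ _ _ (fun y _ => noiseKer_nonneg hρ x y)
    (sum_noiseKer ρ x) (fun y _ => hg y) hq

lemma sum_noise (ρ : Fin n → ℝ) (f : Cube n → E) : ∑ x, noise ρ f x = ∑ x, f x := by
  simp_rw [noise_apply]
  rw [Finset.sum_comm]
  simp_rw [← Finset.sum_smul, sum_noiseKer_left, one_smul]

lemma cubeAvg_noise (ρ : Fin n → ℝ) (f : Cube n → E) : cubeAvg (noise ρ f) = cubeAvg f := by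
  rw [cubeAvg, sum_noise, cubeAvg]

lemma cubeAvg_mono {g h : Cube n → ℝ} (hgh : ∀ x, g x ≤ h x) : cubeAvg g ≤ cubeAvg h :=
  smul_le_smul_of_nonneg_left (Finset.sum_le_sum fun x _ => hgh x) (by positivity)

lemma cubeAvg_nonneg {g : Cube n → ℝ} (hg : ∀ x, 0 ≤ g x) : 0 ≤ cubeAvg g :=
  mul_nonneg (by positivity) (Finset.sum_nonneg fun x _ => hg x)

lemma cubeAvg_const (c : ℝ) : cubeAvg (fun _ : Cube n => c) = c := by
  simp [cubeAvg]

lemma cubeAvg_rpow_norm_noise_le {ρ : Fin n → ℝ} (hρ : ∀ i, |ρ i| ≤ 1) {p : ℝ} (hp : 1 ≤ p)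
    (f : Cube n → E) :
    cubeAvg (fun x => ‖noise ρ f x‖ ^ p) ≤ cubeAvg (fun x => ‖f x‖ ^ p) := by
  rw [← cubeAvg_noise ρ (fun x => ‖f x‖ ^ p)]
  refine cubeAvg_mono fun x => ?_
  refine (Real.rpow_le_rpow (norm_nonneg _) (norm_noise_le hρ f x) (by linarith)).trans ?_
  exact noise_rpow_le hρ (fun x => norm_nonneg _) hp x

end noise

section cubeLp

variable {n : ℕ}

lemma cubeLp_eq (p : ℝ) (f : Cube n → E) :
    cubeLp p f = cubeAvg (fun x => ‖f x‖ ^ p) ^ (1 / p) := rfl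

lemma cubeAvg_rpow_norm_nonneg (p : ℝ) (f : Cube n → E) : 0 ≤ cubeAvg (fun x => ‖f x‖ ^ p) :=
  cubeAvg_nonneg fun x => by positivity

lemma cubeLp_nonneg (p : ℝ) (f : Cube n → E) : 0 ≤ cubeLp p f :=
  Real.rpow_nonneg (cubeAvg_rpow_norm_nonneg p f) _

lemma cubeLp_rpow {p : ℝ} (hp : 0 < p) (f : Cube n → E) :
    cubeLp p f ^ p = cubeAvg (fun x => ‖f x‖ ^ p) := by
  rw [cubeLp_eq, ← Real.rpow_mul (cubeAvg_rpow_norm_nonneg p f), one_div_mul_cancel hp.ne',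
    Real.rpow_one]

lemma cubeLp_noise_le [NormedSpace ℝ E] {ρ : Fin n → ℝ} (hρ : ∀ i, |ρ i| ≤ 1) {p : ℝ} (hp : 1 ≤ p)
    (f : Cube n → E) : cubeLp p (noise ρ f) ≤ cubeLp p f :=
  Real.rpow_le_rpow (cubeAvg_rpow_norm_nonneg p _) (cubeAvg_rpow_norm_noise_le hρ hp f)
    (by positivity)

lemma cubeLp_eq_norm {p : ℝ} (hp : 0 < p) (f : Cube n → E) :
    cubeLp p f = ((2 ^ n : ℝ)⁻¹) ^ (1 / p) * ‖WithLp.toLp (ENNReal.ofReal p) f‖ := by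
  have h : (ENNReal.ofReal p).toReal = p := ENNReal.toReal_ofReal hp.le
  rw [PiLp.norm_eq_sum (by rw [h]; exact hp), h, cubeLp, Real.mul_rpow (by positivity)
    (Finset.sum_nonneg fun x _ => by positivity)]

lemma cubeLp_add_le {p : ℝ} (hp : 1 ≤ p) (f g : Cube n → E) :
    cubeLp p (f + g) ≤ cubeLp p f + cubeLp p g := by
  have : Fact (1 ≤ ENNReal.ofReal p) := ⟨by simpa using hp⟩
  have hp0 : 0 < p := by linarith
  rw [cubeLp_eq_norm hp0, cubeLp_eq_norm hp0, cubeLp_eq_norm hp0, ← mul_add, WithLp.toLp_add]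
  gcongr
  exact norm_add_le _ _

lemma cubeLp_smul [NormedSpace ℝ E] {p : ℝ} (hp : 1 ≤ p) (c : ℝ) (f : Cube n → E) :
    cubeLp p (c • f) = |c| * cubeLp p f := by
  have : Fact (1 ≤ ENNReal.ofReal p) := ⟨by simpa using hp⟩
  have hp0 : 0 < p := by linarith
  rw [cubeLp_eq_norm hp0, cubeLp_eq_norm hp0, WithLp.toLp_smul, norm_smul, Real.norm_eq_abs]
  ring

lemma cubeLp_sum_le {ι : Type*} {p : ℝ} (hp : 1 ≤ p) (s : Finset ι) (f : ι → Cube n → E) :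
    cubeLp p (∑ i ∈ s, f i) ≤ ∑ i ∈ s, cubeLp p (f i) := by
  have : Fact (1 ≤ ENNReal.ofReal p) := ⟨by simpa using hp⟩
  have hp0 : 0 < p := by linarith
  simp_rw [cubeLp_eq_norm hp0]
  rw [← Finset.mul_sum, WithLp.toLp_sum]
  gcongr
  exact norm_sum_le _ _

end cubeLp

lemma noise_const_eq_sum_walsh [NormedSpace ℝ E] {n : ℕ} (r : ℝ) (f : Cube n → E) (x : Cube n) :
    noise (fun _ => r) f x = ∑ A : Finset (Fin n), (r ^ A.card * walshC A x) • fhatC f A := by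
  have key : ∀ y : Cube n, noiseKer (fun _ => r) x y =
      ∑ A : Finset (Fin n), (r ^ A.card * walshC A x) * ((2 ^ n : ℝ)⁻¹ * walshC A y) := by
    intro y
    have h1 : noiseKer (fun _ => r) x y
        = (2 ^ n : ℝ)⁻¹ * ∏ i, (1 + r * sgn' (x i) * sgn' (y i)) := by
      simp [noiseKer, Finset.prod_div_distrib, div_eq_inv_mul (∏ i, _)]
    rw [h1, Finset.prod_one_add, Finset.powerset_univ, Finset.mul_sum]
    refine Finset.sum_congr rfl fun A _ => ?_
    rw [Finset.prod_mul_distrib, Finset.prod_mul_distrib, Finset.prod_const, walshC, walshC]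
    ring
  rw [noise_apply]
  simp_rw [key, Finset.sum_smul]
  rw [Finset.sum_comm]
  refine Finset.sum_congr rfl fun A _ => ?_
  simp only [fhatC, Finset.smul_sum, smul_smul, mul_assoc]

section scalar

variable {n : ℕ}

lemma cubeAvg_noise_mul (ρ : Fin n → ℝ) (u v : Cube n → ℝ) :
    cubeAvg (fun x => noise ρ u x * v x) = cubeAvg (fun x => u x * noise ρ v x) := by
  simp only [cubeAvg, noise_apply, Finset.sum_mul, Finset.mul_sum, smul_eq_mul]
  rw [Finset.sum_comm]
  refine Finset.sum_congr rfl fun y _ => Finset.sum_congr rfl fun x _ => ?_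
  rw [noiseKer_comm]
  ring

lemma cubeAvg_noise_const_mul (r : ℝ) (u : Cube n → ℝ) :
    cubeAvg (fun x => noise (fun _ => r) u x * u x)
      = ∑ A : Finset (Fin n), r ^ A.card * fhatC u A ^ 2 := by
  simp only [cubeAvg, noise_const_eq_sum_walsh, Finset.sum_mul, smul_eq_mul]
  rw [Finset.sum_comm, Finset.mul_sum]
  refine Finset.sum_congr rfl fun A _ => ?_
  rw [sq]
  nth_rewrite 3 [fhatC]
  simp only [smul_eq_mul, Finset.mul_sum]
  exact Finset.sum_congr rfl fun x _ => by ring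

lemma cubeAvg_mul_sq_le (a b : Cube n → ℝ) :
    cubeAvg (fun x => a x * b x) ^ 2
      ≤ cubeAvg (fun x => a x ^ 2) * cubeAvg (fun x => b x ^ 2) := by
  have h := Finset.sum_mul_sq_le_sq_mul_sq (Finset.univ : Finset (Cube n)) a b
  simp only [cubeAvg, smul_eq_mul]
  have h2 : (0 : ℝ) ≤ ((2 ^ n : ℝ)⁻¹) ^ 2 := by positivity
  calc _ = ((2 ^ n : ℝ)⁻¹) ^ 2 * (∑ x, a x * b x) ^ 2 := by ring
    _ ≤ ((2 ^ n : ℝ)⁻¹) ^ 2 * ((∑ x, a x ^ 2) * ∑ x, b x ^ 2) :=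
        mul_le_mul_of_nonneg_left h h2
    _ = _ := by ring

lemma sum_cube_succ (F : Cube (n + 1) → ℝ) :
    ∑ x, F x = ∑ x : Cube n, (F (Fin.cons true x) + F (Fin.cons false x)) := by
  rw [← (Fin.consEquiv (fun _ : Fin (n + 1) => Bool)).sum_comp, Fintype.sum_prod_type,
    Fintype.sum_bool, ← Finset.sum_add_distrib]
  rfl

lemma cubeAvg_succ (F : Cube (n + 1) → ℝ) :
    cubeAvg F = cubeAvg (fun x : Cube n => (F (Fin.cons true x) + F (Fin.cons false x)) / 2) := by
  simp only [cubeAvg, smul_eq_mul, sum_cube_succ, ← Finset.sum_div]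
  rw [pow_succ]
  field_simp

lemma noise_const_cons (r : ℝ) (g : Cube (n + 1) → ℝ) (b : Bool) (x : Cube n) :
    noise (fun _ => r) g (Fin.cons b x) =
      noise (fun _ => r) (fun y => (g (Fin.cons true y) + g (Fin.cons false y)) / 2) x
      + sgn' b * r *
        noise (fun _ => r) (fun y => (g (Fin.cons true y) - g (Fin.cons false y)) / 2) x := by
  simp only [noise_apply, smul_eq_mul, sum_cube_succ, Finset.mul_sum, ← Finset.sum_add_distrib]
  refine Finset.sum_congr rfl fun y _ => ?_
  simp only [noiseKer, Fin.prod_univ_succ, Fin.cons_zero, Fin.cons_succ, sgn'_true, sgn'_false]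
  ring

lemma cubeAvg_add (f g : Cube n → ℝ) :
    cubeAvg (fun x => f x + g x) = cubeAvg f + cubeAvg g := by
  simp only [cubeAvg, smul_eq_mul, Finset.sum_add_distrib, mul_add]

lemma cubeAvg_const_mul (c : ℝ) (f : Cube n → ℝ) :
    cubeAvg (fun x => c * f x) = c * cubeAvg f := by
  simp only [cubeAvg, smul_eq_mul, ← Finset.mul_sum]
  ring

/-- Bonami's `(2,4)` hypercontractive inequality. -/
lemma bonami_four {r : ℝ} (hr : r ^ 2 = 1 / 3) : ∀ {n : ℕ} (g : Cube n → ℝ),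
    cubeAvg (fun x => noise (fun _ => r) g x ^ 4) ≤ cubeAvg (fun x => g x ^ 2) ^ 2
  | 0, g => by
    simp [cubeAvg, noise_apply, noiseKer, ← pow_mul]
  | n + 1, g => by
    set u : Cube n → ℝ := fun y => (g (Fin.cons true y) + g (Fin.cons false y)) / 2 with hu
    set v : Cube n → ℝ := fun y => (g (Fin.cons true y) - g (Fin.cons false y)) / 2 with hv
    set a := noise (fun _ => r) u
    set b := noise (fun _ => r) v
    have e1 : cubeAvg (fun x => noise (fun _ => r) g x ^ 4) =
        cubeAvg (fun x => a x ^ 4) + (2 * cubeAvg (fun x => a x ^ 2 * b x ^ 2)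
          + (1 / 9) * cubeAvg (fun x => b x ^ 4)) := by
      rw [cubeAvg_succ, ← cubeAvg_const_mul, ← cubeAvg_const_mul, ← cubeAvg_add, ← cubeAvg_add]
      congr 1
      ext x
      rw [noise_const_cons, noise_const_cons, sgn'_true, sgn'_false]
      have hr4 : r ^ 4 = 1 / 9 := by rw [show r ^ 4 = (r ^ 2) ^ 2 by ring, hr]; norm_num
      linear_combination (6 * a x ^ 2 * b x ^ 2) * hr + (b x ^ 4) * hr4
    have e2 : cubeAvg (fun x => g x ^ 2) =
        cubeAvg (fun x => u x ^ 2) + cubeAvg (fun x => v x ^ 2) := by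
      rw [cubeAvg_succ, ← cubeAvg_add]
      congr 1
      ext x
      simp only [hu, hv]
      ring
    have ha := bonami_four hr u
    have hb := bonami_four hr v
    have hab := cubeAvg_mul_sq_le (fun x => a x ^ 2) (fun x => b x ^ 2)
    simp only [← pow_mul] at hab
    have hU : 0 ≤ cubeAvg (fun x => u x ^ 2) := cubeAvg_nonneg fun x => sq_nonneg _
    have hV : 0 ≤ cubeAvg (fun x => v x ^ 2) := cubeAvg_nonneg fun x => sq_nonneg _
    have hA : 0 ≤ cubeAvg (fun x => a x ^ 4) := cubeAvg_nonneg fun x => by positivity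
    have hB : 0 ≤ cubeAvg (fun x => b x ^ 4) := cubeAvg_nonneg fun x => by positivity
    have hab' : cubeAvg (fun x => a x ^ 2 * b x ^ 2) ≤
        cubeAvg (fun x => u x ^ 2) * cubeAvg (fun x => v x ^ 2) := by
      refine (abs_le_of_sq_le_sq' (hab.trans ?_) (mul_nonneg hU hV)).2
      rw [mul_pow]
      exact mul_le_mul ha hb hB (sq_nonneg _)
    rw [e1, e2]
    nlinarith [hab', ha, hb]

lemma sum_holder {ι : Type*} (s : Finset ι) {w a b : ι → ℝ} (hw : ∀ i, 0 ≤ w i)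
    (ha : ∀ i, 0 ≤ a i) (hb : ∀ i, 0 ≤ b i) {θ : ℝ} (h0 : 0 ≤ θ) (h1 : θ ≤ 1) :
    ∑ i ∈ s, w i * (a i ^ θ * b i ^ (1 - θ))
      ≤ (∑ i ∈ s, w i * a i) ^ θ * (∑ i ∈ s, w i * b i) ^ (1 - θ) := by
  rcases h0.eq_or_lt with rfl | h0
  · simp
  rcases h1.eq_or_lt with rfl | h1
  · simp
  have hpq : (1 / θ).HolderConjugate (1 / (1 - θ)) := by
    rw [Real.holderConjugate_iff]
    refine ⟨by rw [lt_div_iff₀ h0]; linarith, by simp⟩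
  have h := Real.inner_le_Lp_mul_Lq_of_nonneg s hpq (f := fun i => (w i * a i) ^ θ)
    (g := fun i => (w i * b i) ^ (1 - θ))
    (fun i _ => Real.rpow_nonneg (mul_nonneg (hw i) (ha i)) _)
    (fun i _ => Real.rpow_nonneg (mul_nonneg (hw i) (hb i)) _)
  have h1' : 1 - θ ≠ 0 := by linarith
  have e1 : ∀ i, ((w i * a i) ^ θ) ^ (1 / θ) = w i * a i := fun i => by
    rw [← Real.rpow_mul (mul_nonneg (hw i) (ha i)), mul_one_div_cancel h0.ne', Real.rpow_one]
  have e2 : ∀ i, ((w i * b i) ^ (1 - θ)) ^ (1 / (1 - θ)) = w i * b i := fun i => by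
    rw [← Real.rpow_mul (mul_nonneg (hw i) (hb i)), mul_one_div_cancel h1', Real.rpow_one]
  simp only [e1, e2, one_div_one_div] at h
  refine le_trans (le_of_eq (Finset.sum_congr rfl fun i _ => ?_)) h
  rw [Real.mul_rpow (hw i) (ha i), Real.mul_rpow (hw i) (hb i)]
  have : w i ^ θ * w i ^ (1 - θ) = w i := by
    rw [← Real.rpow_add' (hw i) (by simp)]; simp
  linear_combination (-(a i ^ θ * b i ^ (1 - θ))) * this

lemma cubeAvg_holder {a b : Cube n → ℝ} (ha : ∀ i, 0 ≤ a i) (hb : ∀ i, 0 ≤ b i) {θ : ℝ}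
    (h0 : 0 ≤ θ) (h1 : θ ≤ 1) :
    cubeAvg (fun x => a x ^ θ * b x ^ (1 - θ)) ≤ cubeAvg a ^ θ * cubeAvg b ^ (1 - θ) := by
  simp only [cubeAvg, smul_eq_mul, Finset.mul_sum]
  exact sum_holder _ (fun _ => by positivity) ha hb h0 h1

lemma cubeAvg_rpow_le {a : Cube n → ℝ} (ha : ∀ i, 0 ≤ a i) {θ : ℝ}
    (h0 : 0 ≤ θ) (h1 : θ ≤ 1) : cubeAvg (fun x => a x ^ θ) ≤ cubeAvg a ^ θ := by
  have h := cubeAvg_holder ha (fun _ => zero_le_one) h0 h1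
  simpa [cubeAvg_const] using h

lemma cubeAvg_noise_third_mul_le {u : Cube n → ℝ} (hu : ∀ x, 0 ≤ u x) :
    cubeAvg (fun x => noise (fun _ => 1 / 3) u x * u x)
      ≤ cubeAvg (fun x => u x ^ 2) ^ (1 / 2 : ℝ) * cubeAvg u := by
  set r : ℝ := √(1 / 3) with hr
  have hr2 : r ^ 2 = 1 / 3 := Real.sq_sqrt (by norm_num)
  set w := noise (fun _ => 1 / 3) u with hw
  set v := noise (fun _ => r) u with hv
  have hwv : w = noise (fun _ => r) v := by
    rw [hv, noise_const_noise_const, ← sq, hr2]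
  have hQ : cubeAvg (fun x => w x * u x) = cubeAvg (fun x => v x ^ 2) := by
    rw [hwv, cubeAvg_noise_mul]
    simp only [sq, hv]
  have hU : 0 ≤ cubeAvg u := cubeAvg_nonneg hu
  have hU2 : 0 ≤ cubeAvg (fun x => u x ^ 2) := cubeAvg_nonneg fun x => sq_nonneg _
  set Q := cubeAvg (fun x => w x * u x) with hQdef
  have hQ0 : 0 ≤ Q := by rw [hQ]; exact cubeAvg_nonneg fun x => sq_nonneg _
  have h4 : cubeAvg (fun x => w x ^ 4) ≤ Q ^ 2 := by
    rw [hQ, hwv]; exact bonami_four hr2 v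
  have h1 : Q ^ 2 ≤ cubeAvg (fun x => w x ^ 2 * u x) * cubeAvg u := by
    have h := cubeAvg_mul_sq_le (fun x => w x * √(u x)) (fun x => √(u x))
    simpa only [mul_assoc, Real.mul_self_sqrt (hu _), mul_pow, Real.sq_sqrt (hu _)] using h
  have h2 : cubeAvg (fun x => w x ^ 2 * u x) ^ 2 ≤ Q ^ 2 * cubeAvg (fun x => u x ^ 2) := by
    have h := cubeAvg_mul_sq_le (fun x => w x ^ 2) u
    simp only [← pow_mul] at h
    exact h.trans (mul_le_mul_of_nonneg_right h4 hU2)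
  rw [← Real.sqrt_eq_rpow]
  rcases hQ0.eq_or_lt with h0 | h0
  · rw [← h0]; positivity
  have h3 : (Q ^ 2) * Q ^ 2 ≤ Q ^ 2 * (cubeAvg (fun x => u x ^ 2) * cubeAvg u ^ 2) := by
    calc Q ^ 2 * Q ^ 2 = (Q ^ 2) ^ 2 := by ring
      _ ≤ (cubeAvg (fun x => w x ^ 2 * u x) * cubeAvg u) ^ 2 :=
          pow_le_pow_left₀ (sq_nonneg _) h1 2
      _ = cubeAvg (fun x => w x ^ 2 * u x) ^ 2 * cubeAvg u ^ 2 := by ring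
      _ ≤ Q ^ 2 * cubeAvg (fun x => u x ^ 2) * cubeAvg u ^ 2 :=
          mul_le_mul_of_nonneg_right h2 (sq_nonneg _)
      _ = _ := by ring
  have h5 := le_of_mul_le_mul_left h3 (by positivity)
  refine (abs_le_of_sq_le_sq' ?_ (by positivity)).2
  rwa [mul_pow, Real.sq_sqrt hU2]

lemma cubeAvg_sq_noise_le {u : Cube n → ℝ} (hu : ∀ x, 0 ≤ u x) {θ : ℝ} (h0 : 0 ≤ θ)
    (h1 : θ ≤ 1) {r : ℝ} (hr : r ^ 2 = (1 / 3 : ℝ) ^ θ) :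
    cubeAvg (fun x => noise (fun _ => r) u x ^ 2)
      ≤ cubeAvg (fun x => u x ^ 2) ^ (1 - θ / 2) * cubeAvg u ^ θ := by
  have hU : 0 ≤ cubeAvg u := cubeAvg_nonneg hu
  have hU2 : 0 ≤ cubeAvg (fun x => u x ^ 2) := cubeAvg_nonneg fun x => sq_nonneg _
  have e1 : cubeAvg (fun x => noise (fun _ => r) u x ^ 2)
      = ∑ A : Finset (Fin n), fhatC u A ^ 2 * (((1 / 3 : ℝ) ^ A.card) ^ θ * 1 ^ (1 - θ)) := by
    have : cubeAvg (fun x => noise (fun _ => r) u x ^ 2)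
        = cubeAvg (fun x => noise (fun _ => r ^ 2) u x * u x) := by
      have h : noise (fun _ : Fin n => r ^ 2) u = noise (fun _ => r) (noise (fun _ => r) u) := by
        rw [noise_const_noise_const, sq]
      rw [h, cubeAvg_noise_mul]
      simp only [sq]
    rw [this, cubeAvg_noise_const_mul, hr]
    refine Finset.sum_congr rfl fun A _ => ?_
    rw [Real.one_rpow, mul_one, mul_comm, ← Real.rpow_mul_natCast (by norm_num),
      ← Real.rpow_natCast_mul (by norm_num), mul_comm θ]
  have e3 : ∑ A : Finset (Fin n), fhatC u A ^ 2 * (1 / 3 : ℝ) ^ A.card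
      = cubeAvg (fun x => noise (fun _ => 1 / 3) u x * u x) := by
    rw [cubeAvg_noise_const_mul]
    exact Finset.sum_congr rfl fun A _ => mul_comm _ _
  have e4 : ∑ A : Finset (Fin n), fhatC u A ^ 2 * (1 : ℝ) = cubeAvg (fun x => u x ^ 2) := by
    have h := cubeAvg_noise_const_mul 1 u
    have h' : noise (fun _ : Fin n => (1 : ℝ)) u = u := noise_one u
    rw [h'] at h
    simp only [← sq, one_pow, one_mul] at h
    simpa using h.symm
  have h := sum_holder (Finset.univ : Finset (Finset (Fin n))) (w := fun A => fhatC u A ^ 2)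
    (a := fun A => (1 / 3 : ℝ) ^ A.card) (b := fun _ => 1) (fun _ => sq_nonneg _)
    (fun _ => by positivity) (fun _ => zero_le_one) h0 h1
  rw [← e1, e3, e4] at h
  refine h.trans ?_
  have h3 : 0 ≤ cubeAvg (fun x => noise (fun _ => 1 / 3) u x * u x) := by
    rw [← e3]; exact Finset.sum_nonneg fun A _ => by positivity
  calc _ ≤ (cubeAvg (fun x => u x ^ 2) ^ (1 / 2 : ℝ) * cubeAvg u) ^ θ
        * cubeAvg (fun x => u x ^ 2) ^ (1 - θ) := by
        gcongr
        exact cubeAvg_noise_third_mul_le hu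
    _ = _ := by
        rw [Real.mul_rpow (by positivity) hU, ← Real.rpow_mul hU2, mul_right_comm,
          ← Real.rpow_add' hU2 (by linarith)]
        congr 2
        ring

end scalar

lemma exists_cubeAvg_rpow_noise_le {p : ℝ} (hp : 1 < p) :
    ∃ κ : ℝ, 0 < κ ∧ ∀ {n : ℕ} (g : Cube n → ℝ), (∀ x, 0 ≤ g x) → ∀ θ : ℝ, 0 ≤ θ → θ ≤ 1 →
      ∀ r : ℝ, 0 ≤ r → r ^ 2 = (1 / 3 : ℝ) ^ θ → κ * θ < 1 ∧
      cubeAvg (fun x => noise (fun _ => r) g x ^ p)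
        ≤ cubeAvg (fun x => g x ^ p) ^ (1 - κ * θ) * cubeAvg g ^ (p * (κ * θ)) := by
  have hp0 : 0 < p := by linarith
  have key : ∀ {n : ℕ} (g : Cube n → ℝ), (∀ x, 0 ≤ g x) → ∀ θ : ℝ, 0 ≤ θ → θ ≤ 1 →
      ∀ r : ℝ, 0 ≤ r → r ^ 2 = (1 / 3 : ℝ) ^ θ →
      cubeAvg (fun x => noise (fun _ => r) (fun y => g y ^ (p / 2)) x ^ 2)
        ≤ cubeAvg (fun x => g x ^ p) ^ (1 - θ / 2) * cubeAvg (fun x => g x ^ (p / 2)) ^ θ := by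
    intro n g hg θ h0 h1 r _ hr2
    have h := cubeAvg_sq_noise_le (u := fun y => g y ^ (p / 2))
      (fun x => Real.rpow_nonneg (hg x) _) h0 h1 hr2
    have e : ∀ x, (g x ^ (p / 2)) ^ 2 = g x ^ p := fun x => by
      rw [← Real.rpow_mul_natCast (hg x)]; congr 1; push_cast; ring
    simpa only [e] using h
  have hr1 : ∀ θ : ℝ, 0 ≤ θ → ∀ r : ℝ, 0 ≤ r → r ^ 2 = (1 / 3 : ℝ) ^ θ → |r| ≤ 1 := by
    intro θ h0 r hr hr2
    rw [← sq_le_one_iff_abs_le_one, hr2]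
    exact Real.rpow_le_one (by norm_num) (by norm_num) h0
  rcases le_total 2 p with h2 | h2
  · refine ⟨1 / (2 * (p - 1)), by apply one_div_pos.2; linarith,
      fun {n} g hg θ h0 h1 r hr hr2 => ?_⟩
    have hκ : 1 / (2 * (p - 1)) * θ < 1 := by
      have : 1 / (2 * (p - 1)) ≤ 1 / 2 := by
        apply one_div_le_one_div_of_le <;> linarith
      nlinarith
    refine ⟨hκ, ?_⟩
    have hM : 0 ≤ cubeAvg g := cubeAvg_nonneg hg
    have hMp : 0 ≤ cubeAvg (fun x => g x ^ p) := cubeAvg_nonneg fun x => Real.rpow_nonneg (hg x) _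
    have hMh : 0 ≤ cubeAvg (fun x => g x ^ (p / 2)) :=
      cubeAvg_nonneg fun x => Real.rpow_nonneg (hg x) _
    have hp1 : 0 < p - 1 := by linarith
    set a : ℝ := p / (2 * (p - 1)) with ha
    have ha0 : 0 ≤ a := by positivity
    have ha1 : a ≤ 1 := by rw [ha, div_le_one (by linarith)]; linarith
    have hint : cubeAvg (fun x => g x ^ (p / 2))
        ≤ cubeAvg g ^ a * cubeAvg (fun x => g x ^ p) ^ (1 - a) := by
      refine le_trans (le_of_eq ?_) (cubeAvg_holder hg (fun x => Real.rpow_nonneg (hg x) p) ha0 ha1)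
      congr 1
      ext x
      have e : a + p * (1 - a) = p / 2 := by rw [ha]; field_simp; ring
      rw [← Real.rpow_mul (hg x), ← Real.rpow_add' (hg x) (by rw [e]; positivity), e]
    calc cubeAvg (fun x => noise (fun _ => r) g x ^ p)
        ≤ cubeAvg (fun x => noise (fun _ => r) (fun y => g y ^ (p / 2)) x ^ 2) := by
          refine cubeAvg_mono fun x => ?_
          have hn := noise_nonneg (ρ := fun _ => r) (fun _ => hr1 θ h0 r hr hr2) hg x
          have hj := noise_rpow_le (ρ := fun _ => r) (fun _ => hr1 θ h0 r hr hr2) hg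
            (q := p / 2) (by linarith) x
          calc noise (fun _ => r) g x ^ p = (noise (fun _ => r) g x ^ (p / 2)) ^ 2 := by
                rw [← Real.rpow_mul_natCast hn]; congr 1; push_cast; ring
            _ ≤ _ := pow_le_pow_left₀ (Real.rpow_nonneg hn _) hj 2
      _ ≤ _ := key g hg θ h0 h1 r hr hr2
      _ ≤ cubeAvg (fun x => g x ^ p) ^ (1 - θ / 2)
          * (cubeAvg g ^ a * cubeAvg (fun x => g x ^ p) ^ (1 - a)) ^ θ := by
          gcongr
      _ = _ := by
          rw [Real.mul_rpow (by positivity) (by positivity), ← Real.rpow_mul hM,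
            ← Real.rpow_mul hMp, mul_left_comm, ← Real.rpow_add' hMp]
          · rw [mul_comm]
            congr 2
            · rw [ha]; field_simp; ring
            · rw [ha]; field_simp
          · have : 1 - θ / 2 + (1 - a) * θ = 1 - 1 / (2 * (p - 1)) * θ := by
              rw [ha]; field_simp; ring
            rw [this]; linarith
  · refine ⟨(p - 1) / 2, by linarith, fun {n} g hg θ h0 h1 r hr hr2 => ?_⟩
    have hκ : (p - 1) / 2 * θ < 1 := by nlinarith
    refine ⟨hκ, ?_⟩
    have hM : 0 ≤ cubeAvg g := cubeAvg_nonneg hg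
    have hMp : 0 ≤ cubeAvg (fun x => g x ^ p) := cubeAvg_nonneg fun x => Real.rpow_nonneg (hg x) _
    have hMh : 0 ≤ cubeAvg (fun x => g x ^ (p / 2)) :=
      cubeAvg_nonneg fun x => Real.rpow_nonneg (hg x) _
    have hr1' : ∀ i : Fin n, |(fun _ : Fin n => r) i| ≤ 1 := fun _ => hr1 θ h0 r hr hr2
    set u : Cube n → ℝ := fun y => g y ^ (p / 2) with hu
    have hu0 : ∀ x, 0 ≤ u x := fun x => Real.rpow_nonneg (hg x) _
    have hint : cubeAvg u ≤ cubeAvg g ^ (p / 2) :=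
      cubeAvg_rpow_le hg (by linarith) (by linarith)
    have hpt : ∀ x, noise (fun _ => r) g x ^ p ≤
        (noise (fun _ => r) u x ^ 2) ^ (p - 1)
          * (noise (fun _ => r) (fun y => g y ^ p) x) ^ (1 - (p - 1)) := by
      intro x
      have hnu := noise_nonneg hr1' hu0 x
      have hnp := noise_nonneg hr1' (fun x => Real.rpow_nonneg (hg x) p) x
      have hθ : 0 ≤ 2 - 2 / p := by
        rw [sub_nonneg, div_le_iff₀ hp0]; linarith
      have hθ1 : 2 - 2 / p ≤ 1 := by
        have : 1 ≤ 2 / p := by rw [le_div_iff₀ hp0]; linarith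
        linarith
      have h := sum_holder Finset.univ (w := noiseKer (fun _ => r) x) (a := u)
        (b := fun y => g y ^ p) (fun y => noiseKer_nonneg hr1' x y) hu0
        (fun x => Real.rpow_nonneg (hg x) p) hθ hθ1
      have e : ∀ y, u y ^ (2 - 2 / p) * (g y ^ p) ^ (1 - (2 - 2 / p)) = g y := by
        intro y
        have e : p / 2 * (2 - 2 / p) + p * (1 - (2 - 2 / p)) = 1 := by field_simp; ring
        rw [hu, ← Real.rpow_mul (hg y), ← Real.rpow_mul (hg y),
          ← Real.rpow_add' (hg y) (by rw [e]; norm_num), e, Real.rpow_one]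
      simp only [e] at h
      have h' : noise (fun _ => r) g x ≤ noise (fun _ => r) u x ^ (2 - 2 / p)
          * (noise (fun _ => r) (fun y => g y ^ p) x) ^ (1 - (2 - 2 / p)) := h
      refine (Real.rpow_le_rpow (noise_nonneg hr1' hg x) h' hp0.le).trans (le_of_eq ?_)
      rw [Real.mul_rpow (by positivity) (by positivity), ← Real.rpow_mul hnu,
        ← Real.rpow_mul hnp, ← Real.rpow_natCast_mul hnu]
      congr 2
      · push_cast; field_simp
      · field_simp; ring
    calc cubeAvg (fun x => noise (fun _ => r) g x ^ p) ≤ _ := cubeAvg_mono hpt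
      _ ≤ _ := cubeAvg_holder (fun x => sq_nonneg _)
          (fun x => noise_nonneg hr1' (fun x => Real.rpow_nonneg (hg x) p) x)
          (by linarith) (by linarith)
      _ ≤ (cubeAvg (fun x => g x ^ p) ^ (1 - θ / 2) * (cubeAvg g ^ (p / 2)) ^ θ) ^ (p - 1)
          * cubeAvg (fun x => g x ^ p) ^ (1 - (p - 1)) := by
          rw [cubeAvg_noise]
          have hk := key g hg θ h0 h1 r hr hr2
          have : 0 ≤ p - 1 := by linarith
          have h0' : 0 ≤ cubeAvg (fun x => noise (fun _ => r) u x ^ 2) :=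
            cubeAvg_nonneg fun x => sq_nonneg _
          have hk' : cubeAvg (fun x => noise (fun _ => r) u x ^ 2) ≤
              cubeAvg (fun x => g x ^ p) ^ (1 - θ / 2) * (cubeAvg g ^ (p / 2)) ^ θ :=
            hk.trans (by gcongr)
          gcongr
      _ = _ := by
          rw [Real.mul_rpow (by positivity) (by positivity), ← Real.rpow_mul hM,
            ← Real.rpow_mul hM, ← Real.rpow_mul hMp, mul_right_comm, ← Real.rpow_add' hMp]
          · congr 2 <;> ring
          · have : (1 - θ / 2) * (p - 1) + (1 - (p - 1)) = 1 - (p - 1) / 2 * θ := by ring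
            rw [this]; linarith

/-- Quantitative smoothing of the heat semigroup in terms of the ratio of the `L_p` and `L_1`
norms. -/
lemma exists_cubeLp_noise_exp_le [NormedSpace ℝ E] {p : ℝ} (hp : 1 < p) :
    ∃ κ : ℝ, 0 < κ ∧ κ ≤ 1 ∧ ∀ {n : ℕ} (f : Cube n → E), 0 < cubeLp p f → 0 < cubeLp 1 f →
      0 ≤ Real.log (cubeLp p f / cubeLp 1 f) → ∀ t : ℝ, 0 ≤ t → t ≤ 1 / 2 →
      cubeLp p (noise (fun _ => Real.exp (-t)) f)
        ≤ cubeLp p f * Real.exp (-(κ * t * Real.log (cubeLp p f / cubeLp 1 f))) := by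
  obtain ⟨κ, hκ, H⟩ := exists_cubeAvg_rpow_noise_le hp
  have hp0 : 0 < p := by linarith
  have hlog : 1 ≤ Real.log 3 := by
    rw [Real.le_log_iff_exp_le (by norm_num)]
    linarith [Real.exp_one_lt_d9]
  refine ⟨min 1 (κ * (2 / Real.log 3)), lt_min one_pos (by positivity), min_le_left _ _,
    fun {n} f hN hM hL t ht ht1 => ?_⟩
  set N := cubeLp p f with hNdef
  set M := cubeLp 1 f with hMdef
  set θ : ℝ := 2 / Real.log 3 * t with hθ
  have hθ0 : 0 ≤ θ := by positivity
  have hθ1 : θ ≤ 1 := by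
    have : θ = 2 * t / Real.log 3 := by rw [hθ]; ring
    rw [this, div_le_one (by linarith)]
    linarith
  have hr2 : Real.exp (-t) ^ 2 = (1 / 3 : ℝ) ^ θ := by
    rw [Real.rpow_def_of_pos (by norm_num), ← Real.exp_nat_mul, one_div, Real.log_inv, hθ]
    congr 1
    push_cast
    field_simp
  obtain ⟨hκθ, h⟩ := H (fun x => ‖f x‖) (fun x => norm_nonneg _) θ hθ0 hθ1 _ (Real.exp_pos _).le hr2
  have hr1 : ∀ i : Fin n, |(fun _ : Fin n => Real.exp (-t)) i| ≤ 1 := fun _ => by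
    rw [abs_of_pos (Real.exp_pos _)]
    exact Real.exp_le_one_iff.2 (by linarith)
  have hM1 : cubeAvg (fun x => ‖f x‖) = M := by
    rw [hMdef, cubeLp_eq]; simp
  have h1 : cubeLp p (noise (fun _ => Real.exp (-t)) f) ≤ N ^ (1 - κ * θ) * M ^ (κ * θ) := by
    have hle : cubeAvg (fun x => ‖noise (fun _ => Real.exp (-t)) f x‖ ^ p) ≤
        (N ^ (1 - κ * θ) * M ^ (κ * θ)) ^ p := by
      calc _ ≤ cubeAvg (fun x => noise (fun _ => Real.exp (-t)) (fun y => ‖f y‖) x ^ p) :=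
            cubeAvg_mono fun x => Real.rpow_le_rpow (norm_nonneg _) (norm_noise_le hr1 f x) hp0.le
        _ ≤ _ := h
        _ = _ := by
          rw [← cubeLp_rpow hp0, hM1, ← hNdef, Real.mul_rpow (by positivity) (by positivity),
            ← Real.rpow_mul hN.le, ← Real.rpow_mul hN.le, ← Real.rpow_mul hM.le,
            mul_comm p, mul_comm p]
    rw [← cubeLp_rpow hp0] at hle
    exact (Real.rpow_le_rpow_iff (cubeLp_nonneg _ _) (by positivity) hp0).1 hle
  refine h1.trans ?_
  have e : N ^ (1 - κ * θ) * M ^ (κ * θ) = N * Real.exp (-(κ * θ * Real.log (N / M))) := by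
    rw [Real.log_div hN.ne' hM.ne', Real.rpow_def_of_pos hN, Real.rpow_def_of_pos hM]
    conv_rhs => rw [← Real.exp_log hN, ← Real.exp_add, Real.exp_log hN]
    rw [← Real.exp_add]
    congr 1
    ring
  rw [e]
  have hc : min 1 (κ * (2 / Real.log 3)) * t ≤ κ * θ := by
    calc min 1 (κ * (2 / Real.log 3)) * t ≤ κ * (2 / Real.log 3) * t := by
          gcongr
          exact min_le_right _ _
      _ = κ * θ := by rw [hθ]; ring
  exact mul_le_mul_of_nonneg_left
    (Real.exp_le_exp.2 (neg_le_neg (mul_le_mul_of_nonneg_right hc hL))) hN.le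

lemma rpow_sum_le_sum_rpow {ι : Type*} (t : Finset ι) {a : ι → ℝ} (ha : ∀ i, 0 ≤ a i) {q : ℝ}
    (h0 : 0 < q) (h1 : q ≤ 1) : (∑ i ∈ t, a i) ^ q ≤ ∑ i ∈ t, a i ^ q := by
  classical
  induction t using Finset.induction_on with
  | empty => simp [Real.zero_rpow h0.ne']
  | insert i t hi ih =>
    rw [Finset.sum_insert hi, Finset.sum_insert hi]
    exact (Real.rpow_add_le_add_rpow (ha i) (Finset.sum_nonneg fun i _ => ha i) h0.le h1).trans
      (by linarith)

lemma norm_sum_sgn'_le [NormedSpace ℝ E] {m : ℕ} (v : Fin m → E) (ε : Cube m) :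
    ‖∑ i, sgn' (ε i) • v i‖ ≤ ∑ i, ‖v i‖ := by
  refine (norm_sum_le _ _).trans (le_of_eq (Finset.sum_congr rfl fun i _ => ?_))
  rw [norm_smul, Real.norm_eq_abs, abs_sgn', one_mul]

lemma sum_rpow_le_card {m : ℕ} {a : Fin m → ℝ} (ha : ∀ i, 0 ≤ a i) {p q : ℝ} (hq : 0 ≤ q)
    (hqp : q ≤ p) (hp : 0 < p) :
    ∑ i, a i ^ q ≤ (m : ℝ) ^ (1 - q / p) * (∑ i, a i ^ p) ^ (q / p) := by
  have h := sum_holder (Finset.univ : Finset (Fin m)) (w := fun _ => 1) (a := fun i => a i ^ p)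
    (b := fun _ => 1) (fun _ => zero_le_one) (fun i => Real.rpow_nonneg (ha i) p)
    (fun _ => zero_le_one) (θ := q / p) (by positivity) (by rwa [div_le_one hp])
  have e : ∀ i, (a i ^ p) ^ (q / p) = a i ^ q := fun i => by
    rw [← Real.rpow_mul (ha i), mul_div_cancel₀ _ hp.ne']
  simp only [e, one_mul, Real.one_rpow, mul_one, Finset.sum_const, Finset.card_univ,
    Fintype.card_fin, nsmul_eq_mul] at h
  rwa [mul_comm] at h

/-- Rademacher type bounds the `p`-th moments of Rademacher sums with a power saving over the
triangle inequality, for every `p > 1`. -/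
lemma exists_rademacher_bound [NormedSpace ℝ E] {s T : ℝ} (hs : 1 < s) (hT : 0 < T)
    (htype : ∀ (m : ℕ) (v : Fin m → E),
      (2 ^ m : ℝ)⁻¹ * ∑ ε : Cube m, ‖∑ i, sgn' (ε i) • v i‖ ^ s ≤ T ^ s * ∑ i, ‖v i‖ ^ s)
    {p : ℝ} (hp : 1 < p) :
    ∃ C β : ℝ, 0 < C ∧ 0 < β ∧ ∀ (m : ℕ) (v : Fin m → E), 0 < m →
      cubeAvg (fun ε : Cube m => ‖∑ i, sgn' (ε i) • v i‖ ^ p)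
        ≤ C * (m : ℝ) ^ (p - 1 - β) * ∑ i, ‖v i‖ ^ p := by
  have hp0 : 0 < p := by linarith
  have hs0 : 0 < s := by linarith
  have htype' : ∀ (m : ℕ) (v : Fin m → E),
      cubeAvg (fun ε : Cube m => ‖∑ i, sgn' (ε i) • v i‖ ^ s) ≤ T ^ s * ∑ i, ‖v i‖ ^ s := htype
  have hn : ∀ {m : ℕ} (v : Fin m → E) (q : ℝ), 0 ≤ ∑ i, ‖v i‖ ^ q := fun v q =>
    Finset.sum_nonneg fun i _ => by positivity
  rcases le_total p s with hps | hps
  · refine ⟨T ^ p, p - 1, by positivity, by linarith, fun m v _ => ?_⟩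
    have hq1 : p / s ≤ 1 := by rwa [div_le_one hs0]
    have e : ∀ x : ℝ, 0 ≤ x → (x ^ s) ^ (p / s) = x ^ p := fun x hx => by
      rw [← Real.rpow_mul hx, mul_div_cancel₀ _ hs0.ne']
    calc cubeAvg (fun ε : Cube m => ‖∑ i, sgn' (ε i) • v i‖ ^ p)
        = cubeAvg (fun ε : Cube m => (‖∑ i, sgn' (ε i) • v i‖ ^ s) ^ (p / s)) := by
          simp only [e _ (norm_nonneg _)]
      _ ≤ cubeAvg (fun ε : Cube m => ‖∑ i, sgn' (ε i) • v i‖ ^ s) ^ (p / s) :=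
          cubeAvg_rpow_le (fun ε => by positivity) (by positivity) hq1
      _ ≤ (T ^ s * ∑ i, ‖v i‖ ^ s) ^ (p / s) :=
          Real.rpow_le_rpow (cubeAvg_nonneg fun ε => by positivity) (htype' m v) (by positivity)
      _ = T ^ p * (∑ i, ‖v i‖ ^ s) ^ (p / s) := by
          rw [Real.mul_rpow (by positivity) (hn v s), e T hT.le]
      _ ≤ T ^ p * ∑ i, (‖v i‖ ^ s) ^ (p / s) := by
          gcongr
          exact rpow_sum_le_sum_rpow _ (fun i => by positivity) (by positivity) hq1
      _ = _ := by simp [e _ (norm_nonneg _)]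
  · refine ⟨T ^ s, s - 1, by positivity, by linarith, fun m v hm => ?_⟩
    have hm0 : (0 : ℝ) < m := by exact_mod_cast hm
    set W := ∑ i, ‖v i‖ ^ p with hW
    have hW0 : 0 ≤ W := hn v p
    have h1 : ∑ i, ‖v i‖ ≤ (m : ℝ) ^ (1 - 1 / p) * W ^ (1 / p) := by
      have h := sum_rpow_le_card (a := fun i => ‖v i‖) (fun i => norm_nonneg _) zero_le_one hp.le hp0
      simpa only [Real.rpow_one] using h
    have h2 : ∑ i, ‖v i‖ ^ s ≤ (m : ℝ) ^ (1 - s / p) * W ^ (s / p) :=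
      sum_rpow_le_card (fun i => norm_nonneg _) hs0.le hps hp0
    have hS : 0 ≤ ∑ i, ‖v i‖ := Finset.sum_nonneg fun i _ => norm_nonneg _
    have hps0 : 0 ≤ p - s := by linarith
    calc cubeAvg (fun ε : Cube m => ‖∑ i, sgn' (ε i) • v i‖ ^ p)
        ≤ cubeAvg (fun ε : Cube m => (∑ i, ‖v i‖) ^ (p - s) * ‖∑ i, sgn' (ε i) • v i‖ ^ s) := by
          refine cubeAvg_mono fun ε => ?_
          calc ‖∑ i, sgn' (ε i) • v i‖ ^ p
              = ‖∑ i, sgn' (ε i) • v i‖ ^ (p - s) * ‖∑ i, sgn' (ε i) • v i‖ ^ s := by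
                rw [← Real.rpow_add' (norm_nonneg _) (by linarith), sub_add_cancel]
            _ ≤ _ := by
                gcongr
                exact norm_sum_sgn'_le v ε
      _ = (∑ i, ‖v i‖) ^ (p - s) * cubeAvg (fun ε : Cube m => ‖∑ i, sgn' (ε i) • v i‖ ^ s) :=
          cubeAvg_const_mul _ _
      _ ≤ ((m : ℝ) ^ (1 - 1 / p) * W ^ (1 / p)) ^ (p - s)
          * (T ^ s * ((m : ℝ) ^ (1 - s / p) * W ^ (s / p))) := by
          gcongr
          · exact cubeAvg_nonneg fun ε => by positivity
          · exact (htype' m v).trans (by gcongr)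
      _ = T ^ s * ((m : ℝ) ^ ((1 - 1 / p) * (p - s)) * (m : ℝ) ^ (1 - s / p))
          * (W ^ (1 / p * (p - s)) * W ^ (s / p)) := by
          rw [Real.mul_rpow (by positivity) (by positivity), ← Real.rpow_mul hm0.le,
            ← Real.rpow_mul hW0]
          ring
      _ = _ := by
          have e1 : 1 / p * (p - s) + s / p = 1 := by field_simp; ring
          have e2 : (1 - 1 / p) * (p - s) + (1 - s / p) = p - 1 - (s - 1) := by field_simp; ring
          rw [← Real.rpow_add hm0, ← Real.rpow_add' hW0 (by rw [e1]; norm_num), e1, e2,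
            Real.rpow_one]

section decay

variable [NormedSpace ℝ E] {n : ℕ}

/-- The conditional expectation of `f` onto the coordinates of colour `k`. -/
def colourProj {m : ℕ} (c : Fin n → Fin m) (k : Fin m) (f : Cube n → E) : Cube n → E :=
  noise (fun i => if c i = k then 1 else 0) f

lemma noise_inv_eq_sum_colourProj {m : ℕ} (hm : 0 < m) (f : Cube n → E) :
    noise (fun _ => (m : ℝ)⁻¹) f
      = ∑ c : Fin n → Fin m, ((m : ℝ) ^ (n + 1))⁻¹ • ∑ k, colourProj c k f := by
  have hm0 : (m : ℝ) ≠ 0 := by positivity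
  have key : ∀ (k : Fin m) (x y : Cube n),
      ∑ c : Fin n → Fin m, noiseKer (fun i => if c i = k then 1 else 0) x y
        = (m : ℝ) ^ n * noiseKer (fun _ => (m : ℝ)⁻¹) x y := by
    intro k x y
    have h := Finset.prod_univ_sum (fun _ : Fin n => (Finset.univ : Finset (Fin m)))
      (fun i j => (1 + (if j = k then 1 else 0) * sgn' (x i) * sgn' (y i)) / 2)
    rw [Fintype.piFinset_univ] at h
    unfold noiseKer
    rw [← h]
    have e : (m : ℝ) ^ n = ∏ _i : Fin n, (m : ℝ) := by simp
    rw [e, ← Finset.prod_mul_distrib]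
    refine Finset.prod_congr rfl fun i _ => ?_
    rw [← Finset.sum_div, Finset.sum_add_distrib]
    simp only [ite_mul, one_mul, zero_mul, Finset.sum_ite_eq', Finset.mem_univ, if_true]
    simp only [Finset.sum_const, Finset.card_univ, Fintype.card_fin, nsmul_eq_mul, mul_one]
    field_simp
  ext x
  simp only [Finset.sum_apply, Pi.smul_apply, colourProj, noise_apply, ← Finset.smul_sum]
  have : ∑ c : Fin n → Fin m, ∑ k : Fin m, ∑ y,
      noiseKer (fun i => if c i = k then 1 else 0) x y • f y
      = ∑ y, ((m : ℝ) ^ (n + 1) * noiseKer (fun _ => (m : ℝ)⁻¹) x y) • f y := by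
    rw [Finset.sum_comm]
    simp_rw [Finset.sum_comm (s := (Finset.univ : Finset (Fin n → Fin m))), ← Finset.sum_smul, key]
    rw [Finset.sum_const, Finset.card_univ, Fintype.card_fin, ← Nat.cast_smul_eq_nsmul ℝ,
      Finset.smul_sum]
    refine Finset.sum_congr rfl fun y _ => ?_
    rw [smul_smul, pow_succ]
    congr 1
    ring
  rw [this, Finset.smul_sum]
  refine Finset.sum_congr rfl fun y _ => ?_
  rw [smul_smul, inv_mul_cancel_left₀ (by positivity)]

lemma noise_colourProj {m : ℕ} (c : Fin n → Fin m) (k : Fin m) (P : Fin m → Bool) (b : Bool)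
    {f : Cube n → E} (hf : cubeAvg f = 0) :
    noise (fun i => if P (c i) = b then 1 else 0) (colourProj c k f)
      = if P k = b then colourProj c k f else 0 := by
  rw [colourProj, noise_noise]
  split_ifs with h
  · congr 2
    ext i
    rw [Pi.mul_apply]
    by_cases hi : c i = k
    · simp [hi, h]
    · simp [hi]
  · have : (fun i => if P (c i) = b then (1 : ℝ) else 0) * (fun i => if c i = k then (1 : ℝ) else 0)
        = 0 := by
      ext i
      rw [Pi.mul_apply]
      by_cases hi : c i = k
      · simp [hi, h]
      · simp [hi]
    rw [this]
    ext x
    rw [noise_zero_apply, hf]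
    rfl

lemma cubeLp_sum_colourProj_le {m : ℕ} (c : Fin n → Fin m) (δ : Cube m) {f : Cube n → E}
    (hf : cubeAvg f = 0) {p : ℝ} (hp : 1 ≤ p) :
    cubeLp p (∑ k, colourProj c k f)
      ≤ 2 * cubeLp p (∑ k, sgn' (δ k) • colourProj c k f) := by
  set h := ∑ k, sgn' (δ k) • colourProj c k f with hh
  have hd : ∑ k, colourProj c k f = noise (fun i => if δ (c i) = true then 1 else 0) h
      + (-1 : ℝ) • noise (fun i => if δ (c i) = false then 1 else 0) h := by
    rw [hh, map_sum, map_sum, Finset.smul_sum, ← Finset.sum_add_distrib]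
    refine Finset.sum_congr rfl fun k _ => ?_
    rw [map_smul, map_smul, noise_colourProj c k δ _ hf, noise_colourProj c k δ _ hf]
    cases δ k <;> simp [sgn']
  have hle : ∀ b, ∀ i : Fin n, |(fun i => if δ (c i) = b then (1 : ℝ) else 0) i| ≤ 1 := by
    intro b i
    simp only
    split_ifs <;> simp
  rw [hd]
  refine (cubeLp_add_le hp _ _).trans ?_
  rw [cubeLp_smul hp, abs_neg, abs_one, one_mul, two_mul]
  exact add_le_add (cubeLp_noise_le (hle true) hp h) (cubeLp_noise_le (hle false) hp h)

lemma cubeAvg_comm {m : ℕ} (F : Cube n → Cube m → ℝ) :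
    cubeAvg (fun x => cubeAvg (fun y => F x y)) = cubeAvg (fun y => cubeAvg (fun x => F x y)) := by
  simp only [cubeAvg, smul_eq_mul, Finset.mul_sum]
  rw [Finset.sum_comm]
  exact Finset.sum_congr rfl fun y _ => Finset.sum_congr rfl fun x _ => by ring

lemma cubeAvg_sum {ι : Type*} (t : Finset ι) (F : ι → Cube n → ℝ) :
    cubeAvg (fun x => ∑ i ∈ t, F i x) = ∑ i ∈ t, cubeAvg (F i) := by
  simp only [cubeAvg, smul_eq_mul, Finset.mul_sum]
  exact Finset.sum_comm

lemma cubeLp_sum_colourProj_le_of_rademacher {p C β : ℝ} (hp : 1 < p) (hC : 0 < C)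
    (H : ∀ (m : ℕ) (v : Fin m → E), 0 < m →
      cubeAvg (fun ε : Cube m => ‖∑ i, sgn' (ε i) • v i‖ ^ p)
        ≤ C * (m : ℝ) ^ (p - 1 - β) * ∑ i, ‖v i‖ ^ p)
    {m : ℕ} (hm : 0 < m) (c : Fin n → Fin m) {f : Cube n → E} (hf : cubeAvg f = 0) :
    cubeLp p (∑ k, colourProj c k f) ≤ 2 * C ^ (1 / p) * (m : ℝ) ^ (1 - β / p) * cubeLp p f := by
  have hp0 : 0 < p := by linarith
  have hm0 : (0 : ℝ) < m := by exact_mod_cast hm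
  have hg : ∀ k, cubeAvg (fun x => ‖colourProj c k f x‖ ^ p) ≤ cubeLp p f ^ p := by
    intro k
    rw [cubeLp_rpow hp0]
    refine cubeAvg_rpow_norm_noise_le (fun i => ?_) hp.le f
    split_ifs <;> simp
  have h1 : cubeLp p (∑ k, colourProj c k f) ^ p
      ≤ 2 ^ p * (C * (m : ℝ) ^ (p - β) * cubeLp p f ^ p) := by
    calc cubeLp p (∑ k, colourProj c k f) ^ p
        = cubeAvg (fun _ : Cube m => cubeLp p (∑ k, colourProj c k f) ^ p) :=
          (cubeAvg_const _).symm
      _ ≤ cubeAvg (fun δ : Cube m =>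
            2 ^ p * cubeAvg (fun x => ‖∑ k, sgn' (δ k) • colourProj c k f x‖ ^ p)) := by
          refine cubeAvg_mono fun δ => ?_
          have h := Real.rpow_le_rpow (cubeLp_nonneg _ _)
            (cubeLp_sum_colourProj_le c δ hf hp.le) hp0.le
          rw [Real.mul_rpow (by norm_num) (cubeLp_nonneg _ _),
            cubeLp_rpow hp0 (∑ k, sgn' (δ k) • colourProj c k f)] at h
          simpa only [Finset.sum_apply, Pi.smul_apply] using h
      _ = 2 ^ p * cubeAvg (fun x => cubeAvg (fun δ : Cube m =>
            ‖∑ k, sgn' (δ k) • colourProj c k f x‖ ^ p)) := by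
          rw [cubeAvg_const_mul, cubeAvg_comm]
      _ ≤ 2 ^ p * cubeAvg (fun x => C * (m : ℝ) ^ (p - 1 - β) *
            ∑ k, ‖colourProj c k f x‖ ^ p) := by
          gcongr
          exact cubeAvg_mono fun x => H m (fun k => colourProj c k f x) hm
      _ = 2 ^ p * (C * (m : ℝ) ^ (p - 1 - β) *
            ∑ k, cubeAvg (fun x => ‖colourProj c k f x‖ ^ p)) := by
          rw [cubeAvg_const_mul, cubeAvg_sum]
      _ ≤ 2 ^ p * (C * (m : ℝ) ^ (p - 1 - β) * ∑ _k : Fin m, cubeLp p f ^ p) := by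
          gcongr with k
          exact hg k
      _ = _ := by
          have : (m : ℝ) ^ (p - β) = (m : ℝ) ^ (p - 1 - β) * m := by
            rw [← Real.rpow_add_one hm0.ne']; congr 1; ring
          rw [this]
          simp only [Finset.sum_const, Finset.card_univ, Fintype.card_fin, nsmul_eq_mul]
          ring
  have hN := cubeLp_nonneg p f
  refine (Real.rpow_le_rpow_iff (cubeLp_nonneg _ _) (by positivity) hp0).1 (h1.trans (le_of_eq ?_))
  rw [Real.mul_rpow (by positivity) hN, Real.mul_rpow (by positivity) (by positivity),
    Real.mul_rpow (by positivity) (by positivity), ← Real.rpow_mul hC.le, ← Real.rpow_mul hm0.le,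
    one_div_mul_cancel hp0.ne', Real.rpow_one, sub_mul, div_mul_cancel₀ _ hp0.ne', one_mul]
  ring

/-- Polynomial decay, in the correlation parameter, of the noise operator on mean-zero functions
with values in a space of nontrivial type. -/
lemma exists_cubeLp_noise_le_rpow {s T : ℝ} (hs : 1 < s) (hT : 0 < T)
    (htype : ∀ (m : ℕ) (v : Fin m → E),
      (2 ^ m : ℝ)⁻¹ * ∑ ε : Cube m, ‖∑ i, sgn' (ε i) • v i‖ ^ s ≤ T ^ s * ∑ i, ‖v i‖ ^ s)
    {p : ℝ} (hp : 1 < p) :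
    ∃ D c : ℝ, 0 < D ∧ 0 < c ∧ ∀ {n : ℕ} (f : Cube n → E), cubeAvg f = 0 →
      ∀ r : ℝ, 0 < r → r ≤ 1 → cubeLp p (noise (fun _ => r) f) ≤ D * r ^ c * cubeLp p f := by
  obtain ⟨C, β, hC, hβ, H⟩ := exists_rademacher_bound hs hT htype hp
  have hp0 : 0 < p := by linarith
  refine ⟨2 * C ^ (1 / p) * 2 ^ (β / p), β / p, by positivity, by positivity,
    fun {n} f hf r hr hr1 => ?_⟩
  set m : ℕ := ⌊1 / r⌋₊ with hm
  have hr1' : 1 ≤ 1 / r := by rwa [le_div_iff₀ hr, one_mul]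
  have hmpos : 0 < m := Nat.floor_pos.2 hr1'
  have hm0 : (0 : ℝ) < m := by exact_mod_cast hmpos
  have hmle : (m : ℝ) ≤ 1 / r := Nat.floor_le (by positivity)
  have hmge : 1 / (2 * r) ≤ m := by
    have h1 : 1 / r < m + 1 := Nat.lt_floor_add_one _
    have h2 : (1 : ℝ) ≤ m := by exact_mod_cast hmpos
    have h3 : 1 / (2 * r) = 1 / r / 2 := by field_simp
    rw [h3]
    linarith
  have hcomp : noise (fun _ : Fin n => r) f
      = noise (fun _ => r * m) (noise (fun _ => (m : ℝ)⁻¹) f) := by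
    rw [noise_const_noise_const, mul_inv_cancel_right₀ hm0.ne']
  have hrm : ∀ i : Fin n, |(fun _ : Fin n => r * (m : ℝ)) i| ≤ 1 := fun _ => by
    rw [abs_of_pos (by positivity), mul_comm, ← le_div_iff₀ hr]
    exact hmle
  have hN := cubeLp_nonneg p f
  have hinv : cubeLp p (noise (fun _ => (m : ℝ)⁻¹) f)
      ≤ 2 * C ^ (1 / p) * (m : ℝ) ^ (-(β / p)) * cubeLp p f := by
    rw [noise_inv_eq_sum_colourProj hmpos]
    calc _ ≤ ∑ c : Fin n → Fin m,
          cubeLp p (((m : ℝ) ^ (n + 1))⁻¹ • ∑ k, colourProj c k f) := cubeLp_sum_le hp.le _ _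
      _ ≤ ∑ _c : Fin n → Fin m, ((m : ℝ) ^ (n + 1))⁻¹ *
          (2 * C ^ (1 / p) * (m : ℝ) ^ (1 - β / p) * cubeLp p f) := by
        refine Finset.sum_le_sum fun c _ => ?_
        rw [cubeLp_smul hp.le, abs_of_pos (by positivity)]
        gcongr
        exact cubeLp_sum_colourProj_le_of_rademacher hp hC H hmpos c hf
      _ = _ := by
        simp only [Finset.sum_const, Finset.card_univ, Fintype.card_fun, Fintype.card_fin,
          nsmul_eq_mul]
        have : (m : ℝ) ^ (1 - β / p) = m * (m : ℝ) ^ (-(β / p)) := by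
          rw [sub_eq_add_neg, Real.rpow_add hm0, Real.rpow_one]
        rw [this, pow_succ]
        push_cast
        field_simp
  rw [hcomp]
  refine (cubeLp_noise_le hrm hp.le _).trans (hinv.trans ?_)
  have hpow : (m : ℝ) ^ (-(β / p)) ≤ 2 ^ (β / p) * r ^ (β / p) := by
    rw [← Real.mul_rpow (by norm_num) hr.le]
    calc (m : ℝ) ^ (-(β / p)) ≤ (1 / (2 * r)) ^ (-(β / p)) :=
          Real.rpow_le_rpow_of_nonpos (by positivity) hmge (by simp; positivity)
      _ = _ := by rw [one_div, Real.inv_rpow (by positivity), Real.rpow_neg (by positivity), inv_inv]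
  calc _ ≤ 2 * C ^ (1 / p) * (2 ^ (β / p) * r ^ (β / p)) * cubeLp p f := by gcongr
    _ = _ := by ring

end decay

lemma cubeLp_pos {n : ℕ} (p : ℝ) {f : Cube n → E} (hf : f ≠ 0) : 0 < cubeLp p f := by
  obtain ⟨x, hx⟩ := Function.ne_iff.1 hf
  refine Real.rpow_pos_of_pos (mul_pos (by positivity) ?_) _
  exact Finset.sum_pos' (fun y _ => by positivity)
    ⟨x, Finset.mem_univ x, Real.rpow_pos_of_pos (norm_pos_iff.2 hx) p⟩

lemma cubeLp_zero {n : ℕ} {p : ℝ} (hp : 0 < p) : cubeLp p (0 : Cube n → E) = 0 := by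
  simp [cubeLp, Real.zero_rpow hp.ne', Real.zero_rpow (inv_ne_zero hp.ne')]

lemma cubeLp_one {n : ℕ} (f : Cube n → E) : cubeLp 1 f = cubeAvg (fun x => ‖f x‖) := by
  simp [cubeLp_eq]

lemma cubeLp_one_le {n : ℕ} {p : ℝ} (hp : 1 ≤ p) (f : Cube n → E) : cubeLp 1 f ≤ cubeLp p f := by
  have hp0 : 0 < p := by linarith
  have h := cubeAvg_rpow_le (a := fun x => ‖f x‖ ^ p) (fun x => by positivity) (θ := 1 / p)
    (by positivity) (by rwa [div_le_one hp0])
  have e : ∀ x, (‖f x‖ ^ p) ^ (1 / p) = ‖f x‖ := fun x => by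
    rw [← Real.rpow_mul (norm_nonneg _), mul_one_div_cancel hp0.ne', Real.rpow_one]
  simp only [e] at h
  rwa [cubeLp_one]

section heat

variable [NormedSpace ℝ E] {n : ℕ}

lemma cubeLp_noise_zero_le {p : ℝ} (hp : 1 ≤ p) (f : Cube n → E) :
    cubeLp p (noise 0 f) ≤ cubeLp 1 f := by
  have hp0 : 0 < p := by linarith
  have h : ‖(cubeAvg f : E)‖ ≤ cubeLp 1 f := by
    rw [cubeLp_one, cubeAvg, cubeAvg, norm_smul, Real.norm_of_nonneg (by positivity), smul_eq_mul]
    gcongr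
    exact norm_sum_le _ _
  refine le_trans (le_of_eq ?_) h
  rw [cubeLp_eq]
  simp only [noise_zero_apply, cubeAvg_const]
  rw [← Real.rpow_mul (norm_nonneg _), mul_one_div_cancel hp0.ne', Real.rpow_one]

lemma noise_sub_noise_zero (r : ℝ) (f : Cube n → E) :
    noise (fun _ => r) (f - noise 0 f) = noise (fun _ => r) f - noise 0 f := by
  rw [map_sub, noise_noise, mul_zero]

lemma cubeAvg_sub_noise_zero (f : Cube n → E) : cubeAvg (f - noise 0 f) = 0 := by
  have h := noise_sub_noise_zero (n := n) 0 f
  have h0 : (fun _ : Fin n => (0 : ℝ)) = 0 := rfl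
  rw [h0, sub_self] at h
  rw [← noise_zero_apply (f - noise 0 f) (fun _ => true), h]
  rfl

lemma noise_sub_noise_zero_apply (r : ℝ) (f : Cube n → E) (x : Cube n) :
    noise (fun _ => r) (f - noise 0 f) x =
      ∑ A ∈ Finset.univ.filter (fun A : Finset (Fin n) => A ≠ ∅),
        (r ^ A.card * walshC A x) • fhatC f A := by
  rw [noise_sub_noise_zero, Pi.sub_apply, noise_const_eq_sum_walsh, sub_eq_iff_eq_add,
    Finset.filter_ne', Finset.sum_erase_eq_sub (Finset.mem_univ _), noise_zero_apply]
  simp [walshC, fhatC, cubeAvg]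

lemma integrableOn_rpow_mul_exp {α c : ℝ} (hα : 0 < α) (hc : 0 < c) :
    IntegrableOn (fun t : ℝ => t ^ (α - 1) * Real.exp (-(c * t))) (Set.Ioi 0) := by
  refine Integrable.of_integral_ne_zero ?_
  rw [Real.integral_rpow_mul_exp_neg_mul_Ioi hα hc]
  have := Real.Gamma_pos_of_pos hα
  positivity

/-- The subordination formula for `Δ^{-α}` reduces its norm to that of the heat semigroup. -/
lemma cubeLp_negLap_le [CompleteSpace E] {p : ℝ} (hp : 1 ≤ p) {α : ℝ} (hα : 0 < α)
    (f : Cube n → E) {B : ℝ → ℝ}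
    (hB : IntegrableOn (fun t => t ^ (α - 1) * B t) (Set.Ioi 0))
    (hle : ∀ t, 0 < t → cubeLp p (noise (fun _ => Real.exp (-t)) (f - noise 0 f)) ≤ B t) :
    cubeLp p (negLap α f) ≤ (Real.Gamma α)⁻¹ * ∫ t in Set.Ioi (0 : ℝ), t ^ (α - 1) * B t := by
  have : Fact (1 ≤ ENNReal.ofReal p) := ⟨by simpa using hp⟩
  have hp0 : 0 < p := by linarith
  have hΓ := Real.Gamma_pos_of_pos hα
  set S := Finset.univ.filter (fun A : Finset (Fin n) => A ≠ ∅) with hS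
  set v : Finset (Fin n) → PiLp (ENNReal.ofReal p) (fun _ : Cube n => E) := fun A =>
    WithLp.toLp (ENNReal.ofReal p) (fun x => walshC A x • fhatC f A) with hv
  set κ : ℝ := ((2 ^ n : ℝ)⁻¹) ^ (1 / p) with hκ
  have hκ0 : 0 < κ := by positivity
  have hcard : ∀ A ∈ S, (0 : ℝ) < A.card := fun A hA => by
    rw [hS, Finset.mem_filter] at hA
    exact_mod_cast Finset.card_pos.2 (Finset.nonempty_iff_ne_empty.2 hA.2)
  have hint : ∫ t in Set.Ioi (0 : ℝ),
      ∑ A ∈ S, (t ^ (α - 1) * Real.exp (-(A.card * t))) • v A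
      = Real.Gamma α • WithLp.toLp (ENNReal.ofReal p) (negLap α f) := by
    rw [integral_finsetSum]
    · have e : WithLp.toLp (ENNReal.ofReal p) (negLap α f)
          = ∑ A ∈ S, ((A.card : ℝ) ^ (-α)) • v A := by
        ext x
        simp [negLap, hv, hS, mul_smul]
      rw [e, Finset.smul_sum]
      refine Finset.sum_congr rfl fun A hA => ?_
      rw [integral_smul_const, Real.integral_rpow_mul_exp_neg_mul_Ioi hα (hcard A hA), smul_smul,
        one_div, Real.inv_rpow (hcard A hA).le, Real.rpow_neg (hcard A hA).le, mul_comm]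
    · intro A hA
      exact (integrableOn_rpow_mul_exp hα (hcard A hA)).smul_const (v A)
  have hpt : ∀ t, ∑ A ∈ S, (t ^ (α - 1) * Real.exp (-(A.card * t))) • v A
      = t ^ (α - 1) • WithLp.toLp (ENNReal.ofReal p)
        (noise (fun _ => Real.exp (-t)) (f - noise 0 f)) := by
    intro t
    ext x
    simp only [PiLp.smul_apply, noise_sub_noise_zero_apply, Finset.smul_sum, ← hS, hv,
      WithLp.ofLp_sum, Finset.sum_apply, WithLp.ofLp_smul, Pi.smul_apply, smul_smul]
    refine Finset.sum_congr rfl fun A _ => ?_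
    rw [← Real.exp_nat_mul, mul_neg, mul_assoc]
  have hnorm : ‖Real.Gamma α • WithLp.toLp (ENNReal.ofReal p) (negLap α f)‖
      ≤ ∫ t in Set.Ioi (0 : ℝ), κ⁻¹ * (t ^ (α - 1) * B t) := by
    rw [← hint]
    refine norm_integral_le_of_norm_le (hB.const_mul _) ?_
    filter_upwards [ae_restrict_mem measurableSet_Ioi] with t ht
    have ht0 : (0 : ℝ) < t := ht
    rw [hpt, norm_smul, Real.norm_of_nonneg (by positivity)]
    have h := hle t ht0
    rw [cubeLp_eq_norm hp0, ← hκ, ← le_div_iff₀' hκ0, div_eq_inv_mul] at h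
    calc _ ≤ t ^ (α - 1) * (κ⁻¹ * B t) := by gcongr
      _ = _ := by ring
  rw [norm_smul, Real.norm_of_nonneg hΓ.le, integral_const_mul] at hnorm
  rw [cubeLp_eq_norm hp0, ← hκ, ← div_eq_inv_mul, le_div_iff₀ hΓ]
  calc _ = κ * (Real.Gamma α * ‖WithLp.toLp (ENNReal.ofReal p) (negLap α f)‖) := by ring
    _ ≤ κ * (κ⁻¹ * ∫ t in Set.Ioi (0 : ℝ), t ^ (α - 1) * B t) := by gcongr
    _ = _ := mul_inv_cancel_left₀ hκ0.ne' _

/-- Decay of the heat semigroup on the mean-zero part of `f`, at short and long times. -/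
lemma exists_cubeLp_heat_le {s T : ℝ} (hs : 1 < s) (hT : 0 < T)
    (htype : ∀ (m : ℕ) (v : Fin m → E),
      (2 ^ m : ℝ)⁻¹ * ∑ ε : Cube m, ‖∑ i, sgn' (ε i) • v i‖ ^ s ≤ T ^ s * ∑ i, ‖v i‖ ^ s)
    {p : ℝ} (hp : 1 < p) :
    ∃ Q c κ : ℝ, 0 < Q ∧ 0 < c ∧ 0 < κ ∧ ∀ {n : ℕ} (f : Cube n → E), f ≠ 0 → ∀ t : ℝ, 0 < t →
      cubeLp p (noise (fun _ => Real.exp (-t)) (f - noise 0 f))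
        ≤ Q * cubeLp p f *
          (Real.exp (-((c + κ * Real.log (cubeLp p f / cubeLp 1 f)) * t))
            + Real.exp (-(κ / 2 * Real.log (cubeLp p f / cubeLp 1 f))) * Real.exp (-(c * t))) := by
  obtain ⟨D, c, hD, hc, hdecay⟩ := exists_cubeLp_noise_le_rpow hs hT htype hp
  obtain ⟨κ, hκ, hκ1, hsmooth⟩ := exists_cubeLp_noise_exp_le (E := E) hp
  refine ⟨2 * Real.exp (c / 2) * (1 + D), c, κ, by positivity, hc, hκ, fun {n} f hf t ht => ?_⟩
  have hN := cubeLp_pos p hf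
  have hM := cubeLp_pos 1 hf
  have hL : 0 ≤ Real.log (cubeLp p f / cubeLp 1 f) := by
    refine Real.log_nonneg ?_
    rw [le_div_iff₀ hM, one_mul]
    exact cubeLp_one_le hp.le f
  have hML : cubeLp 1 f = cubeLp p f * Real.exp (-Real.log (cubeLp p f / cubeLp 1 f)) := by
    rw [Real.exp_neg, Real.exp_log (by positivity)]
    field_simp
  set L := Real.log (cubeLp p f / cubeLp 1 f) with hLdef
  set N := cubeLp p f with hNdef
  have hshort : ∀ t : ℝ, 0 ≤ t → t ≤ 1 / 2 →
      cubeLp p (noise (fun _ => Real.exp (-t)) (f - noise 0 f))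
        ≤ 2 * N * Real.exp (-(κ * t * L)) := by
    intro t ht ht1
    rw [noise_sub_noise_zero, sub_eq_add_neg, ← neg_one_smul ℝ (noise 0 f)]
    refine (cubeLp_add_le hp.le _ _).trans ?_
    rw [cubeLp_smul hp.le, abs_neg, abs_one, one_mul]
    have h1 := hsmooth f hN hM hL t ht ht1
    have h2 := cubeLp_noise_zero_le hp.le f
    have h3 : N * Real.exp (-L) ≤ N * Real.exp (-(κ * t * L)) := by
      have : κ * t ≤ 1 := by nlinarith
      gcongr
      nlinarith
    linarith
  rcases le_total t (1 / 2) with h | h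
  · refine (hshort t ht.le h).trans ?_
    have h1 : 1 ≤ Real.exp (c / 2) * Real.exp (-(c * t)) := by
      rw [← Real.exp_add]
      exact Real.one_le_exp (by nlinarith)
    have h2 : Real.exp (-((c + κ * L) * t)) = Real.exp (-(c * t)) * Real.exp (-(κ * t * L)) := by
      rw [← Real.exp_add]; congr 1; ring
    rw [h2]
    calc 2 * N * Real.exp (-(κ * t * L))
        ≤ 2 * N * Real.exp (-(κ * t * L)) * ((Real.exp (c / 2) * Real.exp (-(c * t))) * (1 + D)) := by
          refine le_mul_of_one_le_right (by positivity) ?_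
          nlinarith
      _ = 2 * Real.exp (c / 2) * (1 + D) * N *
          (Real.exp (-(c * t)) * Real.exp (-(κ * t * L))) := by ring
      _ ≤ _ := by
          gcongr
          exact le_add_of_nonneg_right (by positivity)
  · have hsplit : noise (fun _ => Real.exp (-t)) (f - noise 0 f) =
        noise (fun _ => Real.exp (-(t - 1 / 2)))
          (noise (fun _ => Real.exp (-(1 / 2))) (f - noise 0 f)) := by
      rw [noise_const_noise_const, ← Real.exp_add,
        show -(t - 1 / 2) + -(1 / 2) = -t by ring]
    have h1 := hdecay (noise (fun _ => Real.exp (-(1 / 2))) (f - noise 0 f))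
      (by rw [cubeAvg_noise, cubeAvg_sub_noise_zero]) (Real.exp (-(t - 1 / 2))) (Real.exp_pos _)
      (Real.exp_le_one_iff.2 (by linarith))
    rw [← hsplit, ← Real.exp_mul] at h1
    have h2 : Real.exp (-(t - 1 / 2) * c) = Real.exp (c / 2) * Real.exp (-(c * t)) := by
      rw [← Real.exp_add]; congr 1; ring
    have h3 : Real.exp (-(κ * (1 / 2) * L)) = Real.exp (-(κ / 2 * L)) := by
      congr 1; ring
    rw [h2] at h1
    refine h1.trans ?_
    calc _ ≤ D * (Real.exp (c / 2) * Real.exp (-(c * t)))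
          * (2 * N * Real.exp (-(κ * (1 / 2) * L))) := by
          gcongr
          exact hshort _ (by norm_num) le_rfl
      _ = 2 * Real.exp (c / 2) * D * N *
          (Real.exp (-(κ / 2 * L)) * Real.exp (-(c * t))) := by rw [h3]; ring
      _ ≤ _ := by
          gcongr
          · linarith
          · exact le_add_of_nonneg_left (by positivity)

end heat

lemma exists_le_div_one_add_rpow {c κ α : ℝ} (hc : 0 < c) (hκ : 0 < κ) (hα : 0 < α) :
    ∃ K : ℝ, 0 < K ∧ ∀ L : ℝ, 0 ≤ L →
      (1 / (c + κ * L)) ^ α + Real.exp (-(κ / 2 * L)) * (1 / c) ^ α ≤ K / (1 + L ^ α) := by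
  refine ⟨(1 / c) ^ α + (1 / κ) ^ α + (1 + (2 * α / κ) ^ α) * (1 / c) ^ α, by positivity,
    fun L hL => ?_⟩
  have hcL : 0 < c + κ * L := by positivity
  rw [le_div_iff₀ (by positivity)]
  have h1 : (1 / (c + κ * L)) ^ α ≤ (1 / c) ^ α := by
    gcongr
    exact le_add_of_nonneg_right (by positivity)
  have h2 : (1 / (c + κ * L)) ^ α * L ^ α ≤ (1 / κ) ^ α := by
    rw [← Real.mul_rpow (by positivity) hL]
    gcongr
    rw [div_mul_eq_mul_div, div_le_div_iff₀ hcL hκ]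
    linarith
  have h3 : Real.exp (-(κ / 2 * L)) ≤ 1 := Real.exp_le_one_iff.2 (by
    rw [neg_nonpos]; positivity)
  have h4 : Real.exp (-(κ / 2 * L)) * L ^ α ≤ (2 * α / κ) ^ α := by
    rw [Real.exp_neg, inv_mul_le_iff₀ (Real.exp_pos _)]
    have e : L = κ / 2 * L / α * (2 * α / κ) := by field_simp
    have e2 : Real.exp (κ / 2 * L) = Real.exp (κ / 2 * L / α) ^ α := by
      rw [← Real.exp_mul, div_mul_cancel₀ _ hα.ne']
    rw [e2, ← Real.mul_rpow (Real.exp_pos _).le (by positivity)]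
    refine Real.rpow_le_rpow hL ?_ hα.le
    nth_rewrite 1 [e]
    gcongr
    linarith [Real.add_one_le_exp (κ / 2 * L / α)]
  have h5 : (0 : ℝ) ≤ (1 / c) ^ α := by positivity
  nlinarith [mul_le_mul_of_nonneg_right h3 h5, mul_le_mul_of_nonneg_right h4 h5]

/-- **Negative powers of the Laplacian on spaces of nontrivial type** (Theorem 5).
If `E` is a complex Banach space of Rademacher type `s` for some `s ∈ (1,2]` with constant `T`,
then for every `p ∈ (1,∞)` and `α ∈ (0,∞)` there is `K = K_p(α,s,T) ∈ (0,∞)` such that every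
`f : 𝒞_n → E` satisfies `‖Δ^{-α}f‖_p ≤ K ‖f‖_p / (1 + log^α(‖f‖_p/‖f‖₁))`.
(When `f ≡ 0` the right-hand side is automatically `0`.) -/
theorem negative_power_laplacian_nontrivial_type
    (E : Type*) [NormedAddCommGroup E] [NormedSpace ℂ E] [CompleteSpace E]
    (s T : ℝ) (hs : 1 < s) (hs2 : s ≤ 2) (hT : 0 < T)
    (htype : ∀ (m : ℕ) (v : Fin m → E),
      (2 ^ m : ℝ)⁻¹ * ∑ ε : Cube m, ‖∑ i, sgn' (ε i) • v i‖ ^ s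
        ≤ T ^ s * ∑ i, ‖v i‖ ^ s)
    (p : ℝ) (hp : 1 < p) (α : ℝ) (hα : 0 < α) :
    ∃ K : ℝ, 0 < K ∧ ∀ (n : ℕ) (f : Cube n → E),
      cubeLp p (negLap α f)
        ≤ K * (cubeLp p f /
            (1 + Real.log (cubeLp p f / cubeLp 1 f) ^ α)) := by
  obtain ⟨Q, c, κ, hQ, hc, hκ, hheat⟩ := exists_cubeLp_heat_le hs hT htype hp
  obtain ⟨K, hK, hfinal⟩ := exists_le_div_one_add_rpow hc hκ hα
  refine ⟨Q * K, by positivity, fun n f => ?_⟩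
  rcases eq_or_ne f 0 with rfl | hf
  · have h0 : negLap α (0 : Cube n → E) = 0 := by
      ext x
      simp [negLap, fhatC]
    rw [h0, cubeLp_zero (by linarith)]
    simp
  have hN := cubeLp_pos p hf
  have hM := cubeLp_pos 1 hf
  have hL : 0 ≤ Real.log (cubeLp p f / cubeLp 1 f) := by
    refine Real.log_nonneg ?_
    rw [le_div_iff₀ hM, one_mul]
    exact cubeLp_one_le hp.le f
  have hheat' := hheat f hf
  have hfin := hfinal _ hL
  set L := Real.log (cubeLp p f / cubeLp 1 f)
  set N := cubeLp p f
  have hcL : 0 < c + κ * L := by positivity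
  have hΓ := Real.Gamma_pos_of_pos hα
  have e : (fun t : ℝ => t ^ (α - 1) * (Q * N *
      (Real.exp (-((c + κ * L) * t)) + Real.exp (-(κ / 2 * L)) * Real.exp (-(c * t)))))
      = fun t => Q * N * (t ^ (α - 1) * Real.exp (-((c + κ * L) * t)))
        + Q * N * Real.exp (-(κ / 2 * L)) * (t ^ (α - 1) * Real.exp (-(c * t))) := by
    ext t
    ring
  have hi1 := (integrableOn_rpow_mul_exp hα hcL).const_mul (Q * N)
  have hi2 := (integrableOn_rpow_mul_exp hα hc).const_mul (Q * N * Real.exp (-(κ / 2 * L)))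
  have h := cubeLp_negLap_le hp.le hα f (by rw [e]; exact hi1.add hi2) hheat'
  rw [e, integral_add hi1 hi2, integral_const_mul, integral_const_mul,
    Real.integral_rpow_mul_exp_neg_mul_Ioi hα hcL, Real.integral_rpow_mul_exp_neg_mul_Ioi hα hc] at h
  calc _ ≤ _ := h
    _ = Q * N * ((1 / (c + κ * L)) ^ α + Real.exp (-(κ / 2 * L)) * (1 / c) ^ α) := by
      field_simp
    _ ≤ Q * N * (K / (1 + L ^ α)) := by gcongr
    _ = _ := by ring

end
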